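/- For integers k ≥ i ≥ 1 and complex q with 0 < |q| < 1, Σ_{n,j≥0} Ē_{k,i}(n,j) q^{n−j} = ((−q;q)_∞/(q;q)_∞) · ( (q^i, q^{2k−i}, q^{2k}; q^{2k})_∞ + (q^{i−1}, q^{2k+1−i}, q^{2k}; q^{2k})_∞ ). -/

import Mathlib

namespace Paper

/-- The four kinds of unitary steps. -/
inductive PStep : Type
  | NE | SE | S | E
  deriving DecidableEq, BEq, Repr

/-- Horizontal displacement of a step. -/
def stepDx : PStep → ℕ
  | .S => 0
  | _ => 1

/-- Vertical displacement of a step. -/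
def stepDy : PStep → ℤ
  | .NE => 1
  | .SE => -1
  | .S => -1
  | .E => 0

/-- Height (`y`-coordinate) after performing the steps of `l`, starting at height `h`. -/
def pathHeight (h : ℕ) (l : List PStep) : ℤ := (h : ℤ) + (l.map stepDy).sum

/-- `x`-coordinate after performing the steps of `l`, starting on the `y`-axis. -/
def pathX (l : List PStep) : ℕ := (l.map stepDx).sum

/-- A valid path: stays in the first quadrant, starts at `(0,h)` on the `y`-axis, ends
on the `x`-axis, South steps only appear directly after a North-East step, East steps
only appear at height `0`, and the path is empty or ends with a South-East or South step. -/
def ValidPath (h : ℕ) (l : List PStep) : Prop :=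
  (∀ m : ℕ, 0 ≤ pathHeight h (l.take m)) ∧
  (∀ m : ℕ, l[m]? = some PStep.S → ∃ m', m = m' + 1 ∧ l[m']? = some PStep.NE) ∧
  (∀ m : ℕ, l[m]? = some PStep.E → pathHeight h (l.take m) = 0) ∧
  pathHeight h l = 0 ∧
  (l = [] ∨ l.getLast? = some PStep.SE ∨ l.getLast? = some PStep.S)

/-- The vertex reached after step `m` is a peak: it is preceded by a North-East step and
followed by a South-East step (NESE peak) or a South step (NES peak). -/
def IsPeak (l : List PStep) (m : ℕ) : Prop :=
  l[m]? = some PStep.NE ∧ (l[m+1]? = some PStep.SE ∨ l[m+1]? = some PStep.S)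

instance (l : List PStep) (m : ℕ) : Decidable (IsPeak l m) := by
  unfold IsPeak; infer_instance

/-- The major index of a path: the sum of the `x`-coordinates of its peaks. -/
def majorIndex (l : List PStep) : ℕ :=
  ∑ m ∈ Finset.range l.length, if IsPeak l m then pathX (l.take (m + 1)) else 0

/-- The number of peaks of a path. -/
def numPeaks (l : List PStep) : ℕ :=
  ((Finset.range l.length).filter fun m => IsPeak l m).card

/-- The number of South steps of a path. -/
def southSteps (l : List PStep) : ℕ := l.count PStep.S

/-- A path satisfies the special `(k,i)`-conditions if it is a valid path starting at
height `k - i` whose height always stays below `k`. -/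
def SpecialPath (k i : ℕ) (l : List PStep) : Prop :=
  ValidPath (k - i) l ∧ ∀ m : ℕ, pathHeight (k - i) (l.take m) < k

/-- `Ebar k i n j` is the number of paths with major index `n` and `j` South steps
satisfying the special `(k,i)`-conditions. -/
noncomputable def Ebar (k i n j : ℕ) : ℕ :=
  Nat.card {l : List PStep // SpecialPath k i l ∧ majorIndex l = n ∧ southSteps l = j}


open scoped Classical

/-- The infinite q-Pochhammer symbol `(x;q)_∞ = ∏_{i≥0} (1 - x qⁱ)`. -/
noncomputable def qPochInf (x q : ℂ) : ℂ := ∏' i : ℕ, (1 - x * q ^ i)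

/-- The finite q-Pochhammer symbol `(x;q)_N = ∏_{i=0}^{N-1} (1 - x qⁱ)`. -/
noncomputable def qPochN (x q : ℂ) (N : ℕ) : ℂ := ∏ i ∈ Finset.range N, (1 - x * q ^ i)

/-- The q-Pochhammer symbol with arbitrary integer index,
`(x;q)_n = (x;q)_∞ / (x qⁿ;q)_∞`. -/
noncomputable def qPochZ (x q : ℂ) (n : ℤ) : ℂ := qPochInf x q / qPochInf (x * q ^ n) q


open Filter Topology

/-! ### Infinite and finite q-Pochhammer symbols -/

lemma summable_norm_mul_pow {q : ℂ} (hq : ‖q‖ < 1) (x : ℂ) :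
    Summable fun i : ℕ => ‖-(x * q ^ i)‖ := by
  simpa using (summable_geometric_of_lt_one (norm_nonneg q) hq).mul_left ‖x‖

lemma multipliable_qPoch {q : ℂ} (hq : ‖q‖ < 1) (x : ℂ) :
    Multipliable fun i : ℕ => 1 - x * q ^ i := by
  simpa [sub_eq_add_neg] using multipliable_one_add_of_summable (summable_norm_mul_pow hq x)

lemma tendsto_qPochN {q : ℂ} (hq : ‖q‖ < 1) (x : ℂ) :
    Tendsto (qPochN x q) atTop (𝓝 (qPochInf x q)) :=
  (multipliable_qPoch hq x).tendsto_prod_tprod_nat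

lemma norm_mul_pow_lt_one {q : ℂ} (hq : ‖q‖ < 1) {x : ℂ} (hx : ‖x‖ < 1) (i : ℕ) :
    ‖x * q ^ i‖ < 1 := by
  rw [norm_mul, norm_pow]
  exact mul_lt_one_of_nonneg_of_lt_one_left (norm_nonneg _) hx
    (pow_le_one₀ (norm_nonneg _) hq.le)

lemma one_sub_ne_zero_of_norm_lt_one {y : ℂ} (hy : ‖y‖ < 1) : 1 - y ≠ 0 := by
  intro h
  rw [← sub_eq_zero.mp h] at hy
  simp at hy

lemma qPochN_ne_zero {q : ℂ} (hq : ‖q‖ < 1) {x : ℂ} (hx : ‖x‖ < 1) (n : ℕ) :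
    qPochN x q n ≠ 0 :=
  Finset.prod_ne_zero_iff.mpr fun i _ =>
    one_sub_ne_zero_of_norm_lt_one (norm_mul_pow_lt_one hq hx i)

lemma qPochInf_ne_zero {q : ℂ} (hq : ‖q‖ < 1) {x : ℂ} (hx : ‖x‖ < 1) : qPochInf x q ≠ 0 := by
  have := tprod_one_add_ne_zero_of_summable (f := fun i : ℕ => -(x * q ^ i))
    (fun i => by
      simpa [sub_eq_add_neg] using
        one_sub_ne_zero_of_norm_lt_one (norm_mul_pow_lt_one hq hx i))
    (summable_norm_mul_pow hq x)
  simpa [qPochInf, sub_eq_add_neg] using this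

lemma qPochN_succ (x q : ℂ) (n : ℕ) : qPochN x q (n + 1) = qPochN x q n * (1 - x * q ^ n) := by
  simp [qPochN, Finset.prod_range_succ]

lemma qPochN_add (x q : ℂ) (n m : ℕ) :
    qPochN x q (n + m) = qPochN x q n * qPochN (x * q ^ n) q m := by
  simp only [qPochN, Finset.prod_range_add, pow_add, mul_assoc]

lemma qPochN_succ_left (x q : ℂ) (n : ℕ) :
    qPochN x q (n + 1) = (1 - x) * qPochN (x * q) q n := by
  rw [add_comm, qPochN_add]
  simp [qPochN]

lemma qPochInf_eq_qPochN_mul {q : ℂ} (hq : ‖q‖ < 1) (x : ℂ) (n : ℕ) :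
    qPochInf x q = qPochN x q n * qPochInf (x * q ^ n) q := by
  have h1 : Tendsto (fun m => qPochN x q (n + m)) atTop (𝓝 (qPochInf x q)) := by
    simpa [add_comm] using (tendsto_add_atTop_iff_nat n).mpr (tendsto_qPochN hq x)
  simp only [qPochN_add] at h1
  exact tendsto_nhds_unique h1 ((tendsto_qPochN hq _).const_mul _)

lemma exists_norm_qPochN_le {q : ℂ} (hq : ‖q‖ < 1) (x : ℂ) :
    ∃ K : ℝ, ∀ n, ‖qPochN x q n‖ ≤ K := by
  obtain ⟨K, hK⟩ := (tendsto_qPochN hq x).norm.bddAbove_range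
  exact ⟨K, fun n => hK ⟨n, rfl⟩⟩

lemma exists_norm_inv_qPochN_le {q : ℂ} (hq : ‖q‖ < 1) {x : ℂ} (hx : ‖x‖ < 1) :
    ∃ K : ℝ, ∀ n, ‖(qPochN x q n)⁻¹‖ ≤ K := by
  obtain ⟨K, hK⟩ := ((tendsto_qPochN hq x).inv₀ (qPochInf_ne_zero hq hx)).norm.bddAbove_range
  exact ⟨K, fun n => hK ⟨n, rfl⟩⟩

/-- The reciprocal `1 / (q;q)_m`, which vanishes for negative `m`. -/
noncomputable def invQFac (q : ℂ) (m : ℤ) : ℂ := if m < 0 then 0 else (qPochN q q m.toNat)⁻¹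

lemma invQFac_natCast (q : ℂ) (m : ℕ) : invQFac q m = (qPochN q q m)⁻¹ := by
  simp [invQFac]

lemma invQFac_of_neg (q : ℂ) {m : ℤ} (hm : m < 0) : invQFac q m = 0 := by
  simp [invQFac, hm]

lemma invQFac_sub_one {q : ℂ} (hq : ‖q‖ < 1) (m : ℤ) :
    invQFac q (m - 1) = (1 - q ^ m) * invQFac q m := by
  rcases lt_trichotomy m 0 with h | rfl | h
  · rw [invQFac_of_neg q h, invQFac_of_neg q (by omega), mul_zero]
  · rw [invQFac_of_neg q (by omega)]; simp
  · obtain ⟨n, rfl⟩ : ∃ n : ℕ, m = (n + 1 : ℕ) := ⟨(m - 1).toNat, by omega⟩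
    have h1 := one_sub_ne_zero_of_norm_lt_one (norm_mul_pow_lt_one hq hq n)
    rw [show ((n + 1 : ℕ) : ℤ) - 1 = (n : ℕ) by push_cast; ring, invQFac_natCast,
      invQFac_natCast, qPochN_succ, zpow_natCast, pow_succ', mul_inv]
    field_simp

lemma exists_norm_invQFac_le {q : ℂ} (hq : ‖q‖ < 1) :
    ∃ K : ℝ, 0 ≤ K ∧ ∀ m, ‖invQFac q m‖ ≤ K := by
  obtain ⟨K, hK⟩ := exists_norm_inv_qPochN_le hq hq
  have hK0 : 0 ≤ K := (norm_nonneg _).trans (hK 0)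
  refine ⟨K, hK0, fun m => ?_⟩
  unfold invQFac
  split_ifs
  · simpa using hK0
  · exact hK _

lemma tendsto_invQFac {q : ℂ} (hq : ‖q‖ < 1) (n : ℤ) :
    Tendsto (fun N : ℕ => invQFac q (N + n)) atTop (𝓝 (qPochInf q q)⁻¹) := by
  have h1 : Tendsto (fun m : ℤ => invQFac q m) atTop (𝓝 (qPochInf q q)⁻¹) := by
    have h2 : Tendsto (fun m : ℤ => (qPochN q q m.toNat)⁻¹) atTop (𝓝 (qPochInf q q)⁻¹) :=
      ((tendsto_qPochN hq q).inv₀ (qPochInf_ne_zero hq hq)).comp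
        (tendsto_atTop_atTop.mpr fun b => ⟨b, fun a ha => by omega⟩)
    refine h2.congr' ?_
    filter_upwards [eventually_ge_atTop 0] with m hm
    simp [invQFac, not_lt.mpr hm]
  exact h1.comp (tendsto_atTop_add_const_right _ _ tendsto_natCast_atTop_atTop)

/-! ### Triangular numbers -/

/-- The binomial coefficient `n (n - 1) / 2` of an integer. -/
def tri (n : ℤ) : ℤ := n * (n - 1) / 2

lemma two_mul_tri (n : ℤ) : 2 * tri n = n * (n - 1) :=
  Int.mul_ediv_cancel' (Int.even_mul_pred_self n).two_dvd

lemma tri_add_one (n : ℤ) : tri (n + 1) = tri n + n := by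
  linarith [two_mul_tri n, two_mul_tri (n + 1)]

lemma tri_neg (n : ℤ) : tri (-n) = tri n + n := by
  linarith [two_mul_tri n, two_mul_tri (-n)]

lemma abs_le_tri_add_two (n : ℤ) : |n| ≤ tri n + 2 := by
  have h := two_mul_tri n
  rcases abs_cases n with ⟨h1, h2⟩ | ⟨h1, h2⟩ <;> rw [h1]
  · nlinarith [sq_nonneg (2 * n - 3)]
  · nlinarith [sq_nonneg (2 * n + 1)]

lemma summable_zpow_abs {t : ℝ} (ht0 : 0 < t) (ht1 : t < 1) : Summable fun n : ℤ => t ^ |n| := by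
  have := summable_geometric_of_lt_one ht0.le ht1
  exact Summable.of_nat_of_neg (by simpa using this) (by simpa using this)

lemma summable_zpow_tri {t : ℝ} (ht0 : 0 < t) (ht1 : t < 1) : Summable fun n : ℤ => t ^ tri n := by
  refine Summable.of_nonneg_of_le (fun n => (zpow_pos ht0 _).le) (fun n => ?_)
    ((summable_zpow_abs ht0 ht1).mul_left (t ^ (-2 : ℤ)))
  rw [← zpow_add₀ ht0.ne']
  exact zpow_le_zpow_right_of_le_one₀ ht0 ht1.le (by linarith [abs_le_tri_add_two n])

/-! ### The Jacobi triple product identity -/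

/-- The terms of the finite form of the Jacobi triple product. -/
noncomputable def jtpTerm (p z : ℂ) (N : ℕ) (n : ℤ) : ℂ :=
  (-1) ^ n * p ^ tri n * z ^ n * (invQFac p (N - n) * invQFac p (N + n))

lemma invQFac_mul_invQFac_eq_zero (p : ℂ) (N : ℕ) {n : ℤ} (hn : n ∉ Finset.Icc (-N : ℤ) N) :
    invQFac p (N - n) * invQFac p (N + n) = 0 := by
  rw [Finset.mem_Icc, not_and_or] at hn
  rcases hn with h | h
  · rw [invQFac_of_neg p (m := N + n) (by omega), mul_zero]
  · rw [invQFac_of_neg p (m := N - n) (by omega), zero_mul]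

lemma summable_mul_invQFac (p : ℂ) (N : ℕ) (c : ℤ → ℂ) :
    Summable fun n : ℤ => c n * (invQFac p (N - n) * invQFac p (N + n)) :=
  summable_of_ne_finset_zero (s := Finset.Icc (-N : ℤ) N) fun n hn => by
    rw [invQFac_mul_invQFac_eq_zero p N hn, mul_zero]

lemma jtpTerm_succ {p z : ℂ} (hp : ‖p‖ < 1) (hp0 : p ≠ 0) (hz : z ≠ 0) (N : ℕ) (n : ℤ) :
    (1 - p ^ (2 * N + 1)) * (1 - p ^ (2 * N + 2)) * jtpTerm p z (N + 1) n =
      (1 + p ^ (2 * N + 1)) * jtpTerm p z N n - p ^ N * z * jtpTerm p z N (n - 1)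
        - p ^ (N + 1) / z * jtpTerm p z N (n + 1) := by
  have e1 : invQFac p (N - n) = (1 - p ^ (N + 1 - n : ℤ)) * invQFac p (N + 1 - n) := by
    rw [← invQFac_sub_one hp]; congr 1; ring
  have e2 : invQFac p (N + n) = (1 - p ^ (N + 1 + n : ℤ)) * invQFac p (N + 1 + n) := by
    rw [← invQFac_sub_one hp]; congr 1; ring
  have e3 : invQFac p (N + (n - 1)) = (1 - p ^ (N + n : ℤ)) * invQFac p (N + n) := by
    rw [← invQFac_sub_one hp]; congr 1; ring
  have e4 : invQFac p (N - (n + 1)) = (1 - p ^ (N - n : ℤ)) * invQFac p (N - n) := by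
    rw [← invQFac_sub_one hp]; congr 1; ring
  have t1 : tri n = tri (n - 1) + (n - 1) := by
    have := tri_add_one (n - 1); rwa [sub_add_cancel] at this
  unfold jtpTerm
  rw [e3, e4, e1, e2, tri_add_one, show (N : ℤ) - (n - 1) = N + 1 - n by ring,
    show (N : ℤ) + (n + 1) = N + 1 + n by ring, t1]
  push_cast
  have m1 : (-1 : ℂ) ≠ 0 := by norm_num
  simp only [zpow_add₀ hp0, zpow_sub₀ hp0, zpow_add₀ hz, zpow_sub₀ hz, zpow_add₀ m1, zpow_sub₀ m1,
    zpow_one, zpow_natCast]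
  have : p ^ n ≠ 0 := zpow_ne_zero _ hp0
  field_simp
  ring

lemma tsum_jtpTerm {p z : ℂ} (hp : ‖p‖ < 1) (hp0 : p ≠ 0) (hz : z ≠ 0) (N : ℕ) :
    ∑' n : ℤ, jtpTerm p z N n = qPochN z p N * qPochN (p / z) p N * invQFac p (2 * N : ℕ) := by
  have hs : ∀ N, Summable (jtpTerm p z N) := fun N => summable_mul_invQFac p N _
  induction N with
  | zero =>
    rw [tsum_eq_single 0]
    · simp [jtpTerm, tri, qPochN, invQFac]
    · intro n hn
      unfold jtpTerm
      rw [invQFac_mul_invQFac_eq_zero, mul_zero]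
      simp only [Finset.mem_Icc]
      push_cast
      omega
  | succ N ih =>
    have hs1 : Summable fun n => jtpTerm p z N (n - 1) := 
      (Equiv.subRight (1 : ℤ)).summable_iff (f := jtpTerm p z N) |>.mpr (hs N)
    have hs2 : Summable fun n => jtpTerm p z N (n + 1) := 
      (Equiv.addRight (1 : ℤ)).summable_iff (f := jtpTerm p z N) |>.mpr (hs N)
    have s1 : ∑' n, jtpTerm p z N (n - 1) = ∑' n, jtpTerm p z N n :=
      (Equiv.subRight (1 : ℤ)).tsum_eq _
    have s2 : ∑' n, jtpTerm p z N (n + 1) = ∑' n, jtpTerm p z N n :=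
      (Equiv.addRight (1 : ℤ)).tsum_eq _
    have key : (1 - p ^ (2 * N + 1)) * (1 - p ^ (2 * N + 2)) * ∑' n, jtpTerm p z (N + 1) n =
        (1 - z * p ^ N) * (1 - p / z * p ^ N) * ∑' n, jtpTerm p z N n := by
      rw [← tsum_mul_left]
      simp only [jtpTerm_succ hp hp0 hz]
      rw [(((hs N).mul_left _).sub (hs1.mul_left _)).tsum_sub (hs2.mul_left _),
        ((hs N).mul_left _).tsum_sub (hs1.mul_left _), tsum_mul_left, tsum_mul_left, tsum_mul_left,
        s1, s2]
      field_simp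
      ring
    have n1 : 1 - p ^ (2 * N + 1) ≠ 0 := one_sub_ne_zero_of_norm_lt_one (by
      rw [pow_succ']; exact norm_mul_pow_lt_one hp hp _)
    have n2 : 1 - p ^ (2 * N + 2) ≠ 0 := one_sub_ne_zero_of_norm_lt_one (by
      rw [pow_succ']; exact norm_mul_pow_lt_one hp hp _)
    apply mul_left_cancel₀ (mul_ne_zero n1 n2)
    rw [key, ih, qPochN_succ, qPochN_succ, show 2 * (N + 1) = 2 * N + 1 + 1 by ring,
      invQFac_natCast, invQFac_natCast, qPochN_succ, qPochN_succ, ← pow_succ', ← pow_succ', mul_inv,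
      mul_inv]
    have := qPochN_ne_zero hp hp (2 * N)
    field_simp

lemma norm_zpow_tri_mul_zpow_le {p z : ℂ} (hp0 : p ≠ 0) (hz : ‖z‖ ≤ 1)
    (hpz : ‖p‖ ≤ ‖z‖) (n : ℤ) : ‖p ^ tri n * z ^ n‖ ≤ ‖p‖ ^ tri |n| := by
  have hp' : 0 < ‖p‖ := norm_pos_iff.mpr hp0
  have hz' : 0 < ‖z‖ := hp'.trans_le hpz
  rw [norm_mul, norm_zpow, norm_zpow]
  rcases abs_cases n with ⟨h1, h2⟩ | ⟨h1, h2⟩ <;> rw [h1]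
  · refine mul_le_of_le_one_right (zpow_pos hp' _).le ?_
    lift n to ℕ using h2
    simpa using pow_le_one₀ hz'.le hz
  · obtain ⟨m, rfl⟩ : ∃ m : ℕ, n = -m := ⟨(-n).toNat, by omega⟩
    rw [tri_neg, neg_neg, zpow_add₀ hp'.ne', mul_assoc]
    refine mul_le_of_le_one_right (zpow_pos hp' _).le ?_
    rw [zpow_neg, zpow_natCast, zpow_natCast, ← div_eq_mul_inv, ← div_pow]
    exact pow_le_one₀ (by positivity) ((div_le_one hz').mpr hpz)

lemma summable_zpow_tri_abs {t : ℝ} (ht0 : 0 < t) (ht1 : t < 1) :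
    Summable fun n : ℤ => t ^ tri |n| := by
  have h : Summable fun n : ℕ => t ^ tri n :=
    (summable_zpow_tri ht0 ht1).comp_injective Nat.cast_injective
  exact Summable.of_nat_of_neg (by simpa using h) (by simpa using h)

/-- The **Jacobi triple product identity** in the closed annulus `‖p‖ ≤ ‖z‖ ≤ 1`. -/
theorem jacobi_triple_product {p z : ℂ} (hp : ‖p‖ < 1) (hp0 : p ≠ 0) (hz : ‖z‖ ≤ 1)
    (hpz : ‖p‖ ≤ ‖z‖) :
    ∑' n : ℤ, (-1) ^ n * p ^ tri n * z ^ n =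
      qPochInf z p * qPochInf (p / z) p * qPochInf p p := by
  have hp' : 0 < ‖p‖ := norm_pos_iff.mpr hp0
  have hz0 : z ≠ 0 := norm_pos_iff.mp (hp'.trans_le hpz)
  have hne := qPochInf_ne_zero hp hp
  obtain ⟨K, hK0, hK⟩ := exists_norm_invQFac_le hp
  have hlim : Tendsto (fun N : ℕ => ∑' n, jtpTerm p z N n) atTop
      (𝓝 (∑' n : ℤ, (-1) ^ n * p ^ tri n * z ^ n *
        ((qPochInf p p)⁻¹ * (qPochInf p p)⁻¹))) := by
    refine tendsto_tsum_of_dominated_convergence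
      (bound := fun n : ℤ => ‖p‖ ^ tri |n| * (K * K)) ((summable_zpow_tri_abs hp' hp).mul_right _)
      (fun n => ?_) (Eventually.of_forall fun N n => ?_)
    · refine Tendsto.const_mul _ (Tendsto.mul ?_ (tendsto_invQFac hp n))
      simpa [sub_eq_add_neg] using tendsto_invQFac hp (-n)
    · unfold jtpTerm
      rw [norm_mul, mul_assoc, norm_mul, norm_zpow, norm_neg, norm_one, one_zpow, one_mul,
        norm_mul (invQFac _ _)]
      exact mul_le_mul (norm_zpow_tri_mul_zpow_le hp0 hz hpz n)
        (mul_le_mul (hK _) (hK _) (norm_nonneg _) hK0) (by positivity) (zpow_pos hp' _).le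
  have hlim2 : Tendsto (fun N : ℕ => ∑' n, jtpTerm p z N n) atTop
      (𝓝 (qPochInf z p * qPochInf (p / z) p * (qPochInf p p)⁻¹)) := by
    simp only [tsum_jtpTerm hp hp0 hz0]
    refine ((tendsto_qPochN hp _).mul (tendsto_qPochN hp _)).mul ?_
    have := (tendsto_invQFac hp 0).comp
      (tendsto_atTop_mono (fun n : ℕ => (by omega : n ≤ 2 * n)) tendsto_id)
    simpa [Function.comp_def] using this
  have := tendsto_nhds_unique hlim hlim2
  rw [tsum_mul_right] at this
  field_simp at this
  rw [this]
  ring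

/-! ### A limiting case of the q-Gauss sum -/

/-- The terms of the series `₁φ₁(a; ab; q, b)`. -/
noncomputable def gaussTerm (q a b : ℂ) (m : ℕ) : ℂ :=
  qPochN a q m * (-b) ^ m * q ^ m.choose 2 * (qPochN q q m)⁻¹ * (qPochN (a * b) q m)⁻¹

lemma summable_pow_choose_two {t : ℝ} (ht0 : 0 ≤ t) (ht1 : t < 1) :
    Summable fun m : ℕ => t ^ m.choose 2 := by
  refine (summable_nat_add_iff 2).mp (Summable.of_nonneg_of_le (fun n => by positivity)
    (fun n => pow_le_pow_of_le_one ht0 ht1.le ?_) (summable_geometric_of_lt_one ht0 ht1))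
  rw [Nat.choose_succ_succ' (n + 1) 1, Nat.choose_one_right]
  omega

lemma exists_norm_gaussTerm_le {q a b : ℂ} (hq : ‖q‖ < 1) (hb : ‖b‖ ≤ 1) (hab : ‖a * b‖ < 1) :
    ∃ K : ℝ, ∀ M m : ℕ, ‖gaussTerm q a (b * q ^ M) m‖ ≤ K * ‖q‖ ^ m.choose 2 := by
  obtain ⟨K₁, h₁⟩ := exists_norm_qPochN_le hq a
  obtain ⟨K₂, h₂⟩ := exists_norm_inv_qPochN_le hq hq
  obtain ⟨K₃, h₃⟩ := exists_norm_qPochN_le hq (a * b)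
  obtain ⟨K₄, h₄⟩ := exists_norm_inv_qPochN_le hq hab
  have p₁ := (norm_nonneg _).trans (h₁ 0)
  have p₂ := (norm_nonneg _).trans (h₂ 0)
  have p₃ := (norm_nonneg _).trans (h₃ 0)
  refine ⟨K₁ * K₂ * (K₃ * K₄), fun M m => ?_⟩
  have e : (qPochN (a * (b * q ^ M)) q m)⁻¹ =
      qPochN (a * b) q M * (qPochN (a * b) q (M + m))⁻¹ := by
    have := qPochN_ne_zero hq hab M
    rw [qPochN_add, mul_inv, mul_inv_cancel_left₀ this, mul_assoc]
  have hbM : ‖(-(b * q ^ M)) ^ m‖ ≤ 1 := by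
    rw [norm_pow, norm_neg, norm_mul, norm_pow]
    exact pow_le_one₀ (by positivity)
      (mul_le_one₀ hb (by positivity) (pow_le_one₀ (norm_nonneg _) hq.le))
  unfold gaussTerm
  rw [e]
  simp only [norm_mul, norm_pow q]
  calc _ ≤ K₁ * 1 * ‖q‖ ^ m.choose 2 * K₂ * (K₃ * K₄) := by
        gcongr
        exacts [h₁ _, h₂ _, h₃ _, h₄ _]
    _ = _ := by ring

lemma gaussTerm_sub {q a b : ℂ} (hq : ‖q‖ < 1) (hab : ‖a * b‖ < 1) (m : ℕ) :
    (1 - a * b) * gaussTerm q a b m - (1 - b) * gaussTerm q a (b * q) m =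
      (1 - a * b) * ((1 - q ^ m) * gaussTerm q a b m)
        - (1 - a * b) * ((1 - q ^ (m + 1)) * gaussTerm q a b (m + 1)) := by
  have n0 : 1 - a * b ≠ 0 := one_sub_ne_zero_of_norm_lt_one hab
  have n1 := one_sub_ne_zero_of_norm_lt_one (norm_mul_pow_lt_one hq hab m)
  have n2 := qPochN_ne_zero hq hab m
  have n3 := qPochN_ne_zero hq hq m
  have n4 := one_sub_ne_zero_of_norm_lt_one (norm_mul_pow_lt_one hq hq m)
  have e : (qPochN (a * (b * q)) q m)⁻¹ =
      (1 - a * b) * (1 - a * b * q ^ m)⁻¹ * (qPochN (a * b) q m)⁻¹ := by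
    have h1 := qPochN_succ_left (a * b) q m
    rw [qPochN_succ, mul_assoc a b q] at h1
    have h2 : qPochN (a * (b * q)) q m = qPochN (a * b) q m * (1 - a * b * q ^ m) / (1 - a * b) := by
      rw [h1]; field_simp
    rw [h2, inv_div]
    field_simp
  unfold gaussTerm
  rw [e, qPochN_succ, qPochN_succ, qPochN_succ, Nat.choose_succ_succ' m 1, Nat.choose_one_right,
    pow_succ' q m, pow_add q m, neg_mul_eq_neg_mul, mul_pow, pow_succ (-b)]
  generalize q ^ m = x at n1 n4 ⊢
  generalize 1 - q * x = y at n4 ⊢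
  field_simp
  ring

lemma one_sub_mul_tsum_gaussTerm {q a b : ℂ} (hq : ‖q‖ < 1) (hb : ‖b‖ ≤ 1) (hab : ‖a * b‖ < 1) :
    (1 - a * b) * ∑' m, gaussTerm q a b m = (1 - b) * ∑' m, gaussTerm q a (b * q) m := by
  obtain ⟨K, hK⟩ := exists_norm_gaussTerm_le hq hb hab
  have hsum := (summable_pow_choose_two (norm_nonneg q) hq).mul_left K
  have s0 : Summable (gaussTerm q a b) := hsum.of_norm_bounded (by simpa using hK 0)
  have s1 : Summable (gaussTerm q a (b * q)) := hsum.of_norm_bounded (by simpa using hK 1)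
  have s2 : Summable fun m => (1 - a * b) * ((1 - q ^ m) * gaussTerm q a b m) := by
    refine Summable.mul_left _ ((hsum.mul_left 2).of_norm_bounded fun m => ?_)
    rw [norm_mul]
    have h1 : ‖1 - q ^ m‖ ≤ 2 := (norm_sub_le _ _).trans (by
      rw [norm_one, norm_pow]
      linarith [pow_le_one₀ (n := m) (norm_nonneg q) hq.le])
    exact mul_le_mul h1 (by simpa using hK 0 m) (norm_nonneg _) zero_le_two
  rw [← sub_eq_zero, ← tsum_mul_left, ← tsum_mul_left,
    ← (s0.mul_left _).tsum_sub (s1.mul_left _)]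
  simp only [gaussTerm_sub hq hab]
  rw [s2.tsum_sub ((summable_nat_add_iff 1).mpr s2), s2.tsum_eq_zero_add]
  simp

lemma tsum_gaussTerm {q a b : ℂ} (hq : ‖q‖ < 1) (hb : ‖b‖ ≤ 1) (hab : ‖a * b‖ < 1) :
    ∑' m, gaussTerm q a b m = qPochInf b q / qPochInf (a * b) q := by
  obtain ⟨K, hK⟩ := exists_norm_gaussTerm_le hq hb hab
  have hsum := (summable_pow_choose_two (norm_nonneg q) hq).mul_left K
  have iter : ∀ M : ℕ, qPochN (a * b) q M * ∑' m, gaussTerm q a b m =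
      qPochN b q M * ∑' m, gaussTerm q a (b * q ^ M) m := by
    intro M
    induction M with
    | zero => simp [qPochN]
    | succ M ih =>
      have h := one_sub_mul_tsum_gaussTerm (a := a) (b := b * q ^ M) hq (by
        rw [norm_mul, norm_pow]
        exact mul_le_one₀ hb (by positivity) (pow_le_one₀ (norm_nonneg _) hq.le)) (by
        rw [← mul_assoc]; exact norm_mul_pow_lt_one hq hab M)
      rw [qPochN_succ, qPochN_succ, mul_right_comm, ih, pow_succ, ← mul_assoc b, mul_assoc _ (1 - _),
        ← h]
      ring
  have hlim : Tendsto (fun M : ℕ => ∑' m, gaussTerm q a (b * q ^ M) m) atTop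
      (𝓝 (∑' m, gaussTerm q a 0 m)) := by
    refine tendsto_tsum_of_dominated_convergence hsum (fun m => ?_) (Eventually.of_forall hK)
    have h0 : Tendsto (fun M : ℕ => b * q ^ M) atTop (𝓝 0) := by
      simpa using (tendsto_pow_atTop_nhds_zero_of_norm_lt_one hq).const_mul b
    have hc : ContinuousAt (fun b => gaussTerm q a b m) 0 := by
      unfold gaussTerm qPochN
      fun_prop (disch := simp)
    exact hc.tendsto.comp h0
  have h1 : ∑' m, gaussTerm q a 0 m = 1 := by
    rw [tsum_eq_single 0 (fun m hm => by simp [gaussTerm, hm])]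
    simp [gaussTerm, qPochN]
  rw [h1] at hlim
  have := tendsto_nhds_unique ((tendsto_qPochN hq (a * b)).mul_const _)
    (((tendsto_qPochN hq b).mul hlim).congr fun M => (iter M).symm)
  rw [eq_div_iff (qPochInf_ne_zero hq hab), mul_comm, this, mul_one]

/-! ### Explicit generating functions graded by the number of peaks -/

/-- The factor `q^(N(N-1)/2) (-q;q)_N` contributed by `N` peaks. -/
noncomputable def peakFactor (q : ℂ) (N : ℕ) : ℂ := q ^ N.choose 2 * qPochN (-q) q N

/-- The coefficients of the alternating sum that expresses the generating function of paths. -/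
noncomputable def altCoeff (q : ℂ) (k : ℕ) (h n : ℤ) : ℂ :=
  (-1) ^ n * q ^ ((k - 1) * n ^ 2 + tri (n + 1) + n * h)

/-- The generating function of the special paths starting at height `h` with `N` peaks. -/
noncomputable def pathSeries (q : ℂ) (k : ℕ) (h : ℤ) (N : ℕ) : ℂ :=
  peakFactor q N * ∑' n : ℤ, altCoeff q k h n * (invQFac q (N - n) * invQFac q (N + n))

lemma add_choose_two (n m : ℕ) : (n + m).choose 2 = n.choose 2 + m.choose 2 + n * m := by
  induction m with
  | zero => simp
  | succ m ih =>
    rw [← add_assoc, Nat.choose_succ_succ' _ 1, Nat.choose_succ_succ' m 1, Nat.choose_one_right,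
      Nat.choose_one_right, ih]
    ring

lemma tri_natCast (n : ℕ) : tri n = n.choose 2 := by
  induction n with
  | zero => simp [tri]
  | succ n ih =>
    rw [Nat.choose_succ_succ' _ 1, Nat.choose_one_right, Nat.cast_succ, tri_add_one, ih]
    push_cast
    ring

lemma peakFactor_mul_invQFac_add (q : ℂ) (n m : ℕ) :
    peakFactor q (m + n) * (invQFac q ((m + n : ℕ) - n) * invQFac q ((m + n : ℕ) + n)) =
      q ^ n.choose 2 * qPochN (-q) q n * (qPochN q q (2 * n))⁻¹ *
        gaussTerm q (-q ^ (n + 1)) (-q ^ n) m := by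
  rw [show ((m + n : ℕ) : ℤ) - n = m by push_cast; ring,
    show ((m + n : ℕ) : ℤ) + n = (2 * n + m : ℕ) by push_cast; ring, invQFac_natCast,
    invQFac_natCast, peakFactor, gaussTerm, add_comm m n, qPochN_add, qPochN_add q q (2 * n),
    add_choose_two, neg_neg, neg_mul_neg, ← pow_add,
    show n + 1 + n = 2 * n + 1 by ring, pow_succ' q (2 * n), pow_succ' q n, pow_add, pow_add, pow_mul,
    neg_mul, mul_inv]
  ring

lemma tsum_peakFactor_natCast {q : ℂ} (hq : ‖q‖ < 1) (n : ℕ) :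
    ∑' N : ℕ, peakFactor q N * (invQFac q (N - n) * invQFac q (N + n)) =
      qPochInf (-q) q / qPochInf q q * (q ^ tri n + q ^ tri (n + 1)) := by
  have hshift : ∑' N : ℕ, peakFactor q N * (invQFac q (N - n) * invQFac q (N + n)) =
      ∑' m : ℕ, peakFactor q (m + n) *
        (invQFac q ((m + n : ℕ) - n) * invQFac q ((m + n : ℕ) + n)) := by
    refine ((add_left_injective n).tsum_eq
      (f := fun N : ℕ => peakFactor q N * (invQFac q (N - n) * invQFac q (N + n))) ?_).symm
    intro N hN
    refine ⟨N - n, Nat.sub_add_cancel ?_⟩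
    by_contra hlt
    exact hN (by simp only [invQFac_of_neg q (m := N - n) (by omega), zero_mul, mul_zero])
  have hab : -q ^ (n + 1) * -q ^ n = q * q ^ (2 * n) := by ring
  have hnorm : ‖-q ^ (n + 1) * -q ^ n‖ < 1 := hab ▸ norm_mul_pow_lt_one hq hq _
  have h1 := qPochInf_eq_qPochN_mul hq q (2 * n)
  have h2 := qPochInf_eq_qPochN_mul hq (-q) n
  have h3 := qPochInf_eq_qPochN_mul hq (-q ^ n) 1
  have h4 := qPochInf_ne_zero hq (norm_mul_pow_lt_one hq hq (2 * n))
  have h5 := qPochN_ne_zero hq hq (2 * n)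
  rw [hshift]
  simp only [peakFactor_mul_invQFac_add]
  rw [tsum_mul_left, tsum_gaussTerm hq
    (by rw [norm_neg, norm_pow]; exact pow_le_one₀ (norm_nonneg _) hq.le) hnorm, hab, h1, h2, h3,
    tri_add_one, tri_natCast, ← Nat.cast_add, zpow_natCast, zpow_natCast, pow_add,
    show -q ^ n * q ^ 1 = -q * q ^ n by ring]
  simp only [qPochN, Finset.prod_range_one] at h5 ⊢
  field_simp
  ring

lemma tsum_peakFactor {q : ℂ} (hq : ‖q‖ < 1) (n : ℤ) :
    ∑' N : ℕ, peakFactor q N * (invQFac q (N - n) * invQFac q (N + n)) =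
      qPochInf (-q) q / qPochInf q q * (q ^ tri n + q ^ tri (n + 1)) := by
  obtain ⟨m, rfl | rfl⟩ := n.eq_nat_or_neg
  · exact tsum_peakFactor_natCast hq m
  · have h := tsum_peakFactor_natCast hq m
    rw [show (-(m : ℤ)) + 1 = -(m - 1) by ring, tri_neg, tri_neg, ← tri_add_one, ← tri_add_one,
      sub_add_cancel, add_comm, ← h]
    refine tsum_congr fun N => ?_
    rw [sub_neg_eq_add, ← sub_eq_add_neg, mul_comm (invQFac q _)]

lemma norm_altCoeff_le {q : ℂ} (hq0 : q ≠ 0) (hq : ‖q‖ < 1) {k : ℕ} {h : ℤ} (h0 : 0 ≤ h)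
    (hk : h < k) (n : ℤ) : ‖altCoeff q k h n‖ ≤ ‖q‖ ^ tri (n + 1) := by
  rw [altCoeff, norm_mul, norm_zpow, norm_neg, norm_one, one_zpow, one_mul, norm_zpow]
  refine zpow_le_zpow_right_of_le_one₀ (norm_pos_iff.mpr hq0) hq.le ?_
  have h1 : 0 ≤ ((k : ℤ) - 1 - h) * n ^ 2 := mul_nonneg (by omega) (sq_nonneg n)
  have h2 : 0 ≤ h * (n ^ 2 + n) := by
    refine mul_nonneg h0 ?_
    rcases le_or_gt 0 n with h | h <;> nlinarith
  nlinarith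

lemma summable_peakFactor_mul_altCoeff {q : ℂ} (hq0 : q ≠ 0) (hq : ‖q‖ < 1) {k : ℕ} {h : ℤ}
    (h0 : 0 ≤ h) (hk : h < k) :
    Summable fun x : ℕ × ℤ => peakFactor q x.1 *
      (altCoeff q k h x.2 * (invQFac q (x.1 - x.2) * invQFac q (x.1 + x.2))) := by
  obtain ⟨K, hK0, hK⟩ := exists_norm_invQFac_le hq
  obtain ⟨L, hL⟩ := exists_norm_qPochN_le hq (-q)
  have hL0 := (norm_nonneg _).trans (hL 0)
  have hq' : 0 < ‖q‖ := norm_pos_iff.mpr hq0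
  have hn : Summable fun n : ℤ => ‖q‖ ^ tri (n + 1) :=
    (Equiv.addRight (1 : ℤ)).summable_iff (f := fun n => ‖q‖ ^ tri n) |>.mpr
      (summable_zpow_tri hq' hq)
  refine (((summable_pow_choose_two hq'.le hq).mul_of_nonneg hn (fun _ => by positivity)
    (fun _ => by positivity)).mul_right (L * (K * K))).of_norm_bounded fun x => ?_
  rw [peakFactor, norm_mul, norm_mul, norm_mul, norm_mul, norm_pow]
  calc _ ≤ ‖q‖ ^ x.1.choose 2 * L * (‖q‖ ^ tri (x.2 + 1) * (K * K)) := by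
        gcongr
        exacts [hL _, norm_altCoeff_le hq0 hq h0 hk _, hK _, hK _]
    _ = _ := by ring

lemma tsum_pathSeries {q : ℂ} (hq0 : q ≠ 0) (hq : ‖q‖ < 1) {k : ℕ} {h : ℤ} (h0 : 0 ≤ h)
    (hk : h < k) :
    ∑' N, pathSeries q k h N = qPochInf (-q) q / qPochInf q q *
      ∑' n : ℤ, (-1) ^ n * (q ^ (k * n ^ 2 + n * h) + q ^ (k * n ^ 2 + n * (h + 1))) := by
  simp only [pathSeries, ← tsum_mul_left]
  rw [← Summable.tsum_comm (f := fun (N : ℕ) (n : ℤ) => peakFactor q N *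
    (altCoeff q k h n * (invQFac q (N - n) * invQFac q (N + n))))
    (summable_peakFactor_mul_altCoeff hq0 hq h0 hk)]
  refine tsum_congr fun n => ?_
  simp only [mul_left_comm (peakFactor q _) (altCoeff q k h n)]
  rw [tsum_mul_left, tsum_peakFactor hq, altCoeff, mul_left_comm, mul_assoc]
  congr 2
  have ht := two_mul_tri n
  rw [mul_add, ← zpow_add₀ hq0, ← zpow_add₀ hq0, tri_add_one]
  congr 2 <;> linear_combination ht

lemma zpow_theta_exponent {q : ℂ} (hq0 : q ≠ 0) {k j : ℕ} (hj : j ≤ k) (n : ℤ) :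
    (q ^ (2 * k)) ^ tri n * (q ^ (2 * k - j)) ^ n = q ^ (k * n ^ 2 + n * (k - j) : ℤ) := by
  rw [← zpow_natCast, ← zpow_natCast, ← zpow_mul, ← zpow_mul, ← zpow_add₀ hq0,
    Nat.cast_sub (by omega)]
  congr 1
  push_cast
  linear_combination (k : ℤ) * two_mul_tri n

lemma norm_pow_le_norm_pow {q : ℂ} (hq : ‖q‖ < 1) {m n : ℕ} (h : m ≤ n) : ‖q ^ n‖ ≤ ‖q ^ m‖ := by
  rw [norm_pow, norm_pow]
  exact pow_le_pow_of_le_one (norm_nonneg _) hq.le h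

lemma norm_pow_lt_one {q : ℂ} (hq : ‖q‖ < 1) {n : ℕ} (h : n ≠ 0) : ‖q ^ n‖ < 1 := by
  rw [norm_pow]
  exact pow_lt_one₀ (norm_nonneg _) hq h

lemma summable_theta {q : ℂ} (hq0 : q ≠ 0) (hq : ‖q‖ < 1) {k j : ℕ} (hk : 0 < k) (hj : j ≤ k) :
    Summable fun n : ℤ => (-1) ^ n * q ^ (k * n ^ 2 + n * (k - j) : ℤ) := by
  have hp0 : q ^ (2 * k) ≠ 0 := pow_ne_zero _ hq0
  refine (summable_zpow_tri_abs (norm_pos_iff.mpr hp0)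
    (norm_pow_lt_one hq (by omega))).of_norm_bounded fun n => ?_
  rw [norm_mul, norm_zpow, norm_neg, norm_one, one_zpow, one_mul, ← zpow_theta_exponent hq0 hj]
  exact norm_zpow_tri_mul_zpow_le hp0 (by simpa using norm_pow_le_norm_pow hq (Nat.zero_le _))
    (norm_pow_le_norm_pow hq (Nat.sub_le _ _)) n

lemma tsum_theta {q : ℂ} (hq0 : q ≠ 0) (hq : ‖q‖ < 1) {k j : ℕ} (hk : 0 < k) (hj : j ≤ k) :
    ∑' n : ℤ, (-1) ^ n * q ^ (k * n ^ 2 + n * (k - j) : ℤ) =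
      qPochInf (q ^ j) (q ^ (2 * k)) * qPochInf (q ^ (2 * k - j)) (q ^ (2 * k)) *
        qPochInf (q ^ (2 * k)) (q ^ (2 * k)) := by
  have h := jacobi_triple_product (p := q ^ (2 * k)) (z := q ^ (2 * k - j))
    (norm_pow_lt_one hq (by omega)) (pow_ne_zero _ hq0)
    (by simpa using norm_pow_le_norm_pow hq (Nat.zero_le _))
    (norm_pow_le_norm_pow hq (Nat.sub_le _ _))
  have hdiv : q ^ (2 * k) / q ^ (2 * k - j) = q ^ j := by
    rw [div_eq_iff (pow_ne_zero _ hq0), ← pow_add]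
    congr 1
    omega
  rw [hdiv, mul_comm (qPochInf (q ^ (2 * k - j)) _)] at h
  rw [← h]
  refine tsum_congr fun n => ?_
  rw [mul_assoc, zpow_theta_exponent hq0 hj]

lemma tsum_pathSeries_eq_qPochInf {q : ℂ} (hq0 : q ≠ 0) (hq : ‖q‖ < 1) {k i : ℕ} (hi : 1 ≤ i)
    (hik : i ≤ k) :
    ∑' N, pathSeries q k (k - i : ℕ) N = qPochInf (-q) q / qPochInf q q *
        (qPochInf (q ^ i) (q ^ (2 * k)) * qPochInf (q ^ (2 * k - i)) (q ^ (2 * k)) *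
            qPochInf (q ^ (2 * k)) (q ^ (2 * k)) +
          qPochInf (q ^ (i - 1)) (q ^ (2 * k)) * qPochInf (q ^ (2 * k + 1 - i)) (q ^ (2 * k)) *
            qPochInf (q ^ (2 * k)) (q ^ (2 * k))) := by
  rw [tsum_pathSeries hq0 hq (Nat.cast_nonneg _) (by omega),
    show 2 * k + 1 - i = 2 * k - (i - 1) by omega,
    ← tsum_theta hq0 hq (by omega) hik, ← tsum_theta hq0 hq (by omega) (by omega : i - 1 ≤ k),
    ← (summable_theta hq0 hq (by omega) hik).tsum_add
      (summable_theta hq0 hq (by omega) (by omega : i - 1 ≤ k))]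
  congr 1
  refine tsum_congr fun n => ?_
  rw [mul_add, Nat.cast_sub hik, Nat.cast_sub hi]
  congr 4
  push_cast
  ring

/-! ### The recurrences satisfied by the explicit generating functions -/

lemma altCoeff_add_height {q : ℂ} (hq0 : q ≠ 0) (k : ℕ) (h e n : ℤ) :
    altCoeff q k (h + e) n = altCoeff q k h n * q ^ (n * e) := by
  rw [altCoeff, altCoeff, mul_assoc, ← zpow_add₀ hq0]
  congr 2
  ring

lemma pathSeries_recurrence {q : ℂ} (hq0 : q ≠ 0) (hq : ‖q‖ < 1) (k : ℕ) (h : ℤ) (N : ℕ) :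
    pathSeries q k h (N + 1) - q ^ (N + 1) * pathSeries q k (h - 1) (N + 1) =
      (q ^ N + q ^ (2 * N + 1)) * pathSeries q k h N + q ^ (N + 1) *
        (pathSeries q k (h + 1) (N + 1) - q ^ (N + 1) * pathSeries q k h (N + 1)) := by
  have hs : ∀ (h : ℤ) (N : ℕ), Summable fun n : ℤ => altCoeff q k h n *
      (invQFac q (N - n) * invQFac q (N + n)) := fun h N => summable_mul_invQFac q N _
  set T : ℤ → ℕ → ℂ := fun h N => ∑' n : ℤ, altCoeff q k h n *
    (invQFac q (N - n) * invQFac q (N + n)) with hT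
  have key : T h N = (1 + q ^ (2 * N + 2)) * T h (N + 1) - q ^ (N + 1) * T (h - 1) (N + 1)
      - q ^ (N + 1) * T (h + 1) (N + 1) := by
    simp only [hT, ← tsum_mul_left]
    rw [← ((hs _ _).mul_left _).tsum_sub ((hs _ _).mul_left _),
      ← (((hs _ _).mul_left _).sub ((hs _ _).mul_left _)).tsum_sub ((hs _ _).mul_left _)]
    refine tsum_congr fun n => ?_
    have e1 : invQFac q (N - n) = (1 - q ^ (N + 1 - n : ℤ)) * invQFac q (N + 1 - n) := by
      rw [← invQFac_sub_one hq]; congr 1; ring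
    have e2 : invQFac q (N + n) = (1 - q ^ (N + 1 + n : ℤ)) * invQFac q (N + 1 + n) := by
      rw [← invQFac_sub_one hq]; congr 1; ring
    rw [e1, e2, sub_eq_add_neg h 1, altCoeff_add_height hq0, altCoeff_add_height hq0]
    push_cast
    simp only [zpow_add₀ hq0, zpow_sub₀ hq0, mul_neg, mul_one, zpow_neg, zpow_natCast, zpow_one]
    have : q ^ n ≠ 0 := zpow_ne_zero _ hq0
    field_simp
    ring
  have hC : peakFactor q (N + 1) = q ^ N * (1 + q ^ (N + 1)) * peakFactor q N := by
    rw [peakFactor, peakFactor, qPochN_succ, Nat.choose_succ_succ' N 1, Nat.choose_one_right]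
    ring
  change peakFactor q (N + 1) * T h (N + 1) - q ^ (N + 1) * (peakFactor q (N + 1) * T (h - 1) (N + 1))
    = (q ^ N + q ^ (2 * N + 1)) * (peakFactor q N * T h N) + q ^ (N + 1) *
      (peakFactor q (N + 1) * T (h + 1) (N + 1) - q ^ (N + 1) * (peakFactor q (N + 1) * T h (N + 1)))
  rw [key, hC]
  ring

lemma pathSeries_neg_one (q : ℂ) (k N : ℕ) :
    pathSeries q k (-1) N = pathSeries q k 0 N := by
  unfold pathSeries
  congr 1
  rw [← (Equiv.neg ℤ).tsum_eq]
  refine tsum_congr fun n => ?_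
  rw [Equiv.neg_apply, sub_neg_eq_add, ← sub_eq_add_neg, mul_comm (invQFac q _), altCoeff, altCoeff,
    zpow_neg, ← inv_zpow, inv_neg_one]
  congr 3
  rw [tri_add_one, tri_add_one, tri_neg]
  ring

lemma pathSeries_top {q : ℂ} (hq0 : q ≠ 0) (hq : ‖q‖ < 1) (k N : ℕ) :
    pathSeries q k (k - 1) N = q ^ N * pathSeries q k (k - 2) N := by
  have hs : ∀ h : ℤ, Summable fun n : ℤ => altCoeff q k h n *
      (invQFac q (N - n) * invQFac q (N + n)) := fun h => summable_mul_invQFac q N _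
  set R : ℤ → ℂ := fun n => altCoeff q k (k - 1) n * (invQFac q (N - n - 1) * invQFac q (N + n))
    with hR
  have hdiff : ∑' n, R n = ∑' n : ℤ, altCoeff q k (k - 1) n * (invQFac q (N - n) * invQFac q (N + n))
      - q ^ N * ∑' n : ℤ, altCoeff q k (k - 2) n * (invQFac q (N - n) * invQFac q (N + n)) := by
    rw [← tsum_mul_left, ← (hs _).tsum_sub ((hs _).mul_left _)]
    refine tsum_congr fun n => ?_
    simp only [hR]
    rw [invQFac_sub_one hq, show (k : ℤ) - 1 = k - 2 + 1 by ring, altCoeff_add_height hq0,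
      zpow_sub₀ hq0, mul_one, zpow_natCast]
    have : q ^ n ≠ 0 := zpow_ne_zero _ hq0
    field_simp
  have hanti : ∑' n, R n = -∑' n, R n := by
    conv_lhs => rw [← (Equiv.subLeft (-1 : ℤ)).tsum_eq]
    rw [← tsum_neg]
    refine tsum_congr fun n => ?_
    have hsign : (-1 : ℂ) ^ (-1 - n) = -(-1) ^ n := by
      rw [zpow_sub₀ (by norm_num), zpow_neg_one, inv_neg_one, div_eq_mul_inv, ← inv_zpow,
        inv_neg_one, neg_one_mul]
    rw [Equiv.subLeft_apply, hR]
    simp only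
    rw [show (N : ℤ) - (-1 - n) - 1 = N + n by ring, show (N : ℤ) + (-1 - n) = N - n - 1 by ring,
      mul_comm (invQFac q _), ← neg_mul, altCoeff, altCoeff, hsign, ← neg_mul,
      show (-1 : ℤ) - n + 1 = -n by ring, tri_neg, tri_add_one]
    congr 3
    ring
  have hzero : ∑' n, R n = 0 := self_eq_neg.mp hanti
  unfold pathSeries
  rw [mul_left_comm, ← sub_eq_zero, ← mul_sub, ← hdiff, hzero, mul_zero]

lemma pathSeries_zero (q : ℂ) (k : ℕ) (h : ℤ) : pathSeries q k h 0 = 1 := by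
  rw [pathSeries, tsum_eq_single 0]
  · simp [peakFactor, altCoeff, tri, qPochN, invQFac]
  · intro n hn
    rw [invQFac_mul_invQFac_eq_zero, mul_zero]
    simp only [Finset.mem_Icc]
    push_cast
    omega

/-! ### Recursive description of paths -/

/-- Paths below height `k` from height `h` to height `0`; the Boolean records whether the
preceding step was a North-East step. -/
def IsWalk (k : ℕ) : Bool → ℕ → List PStep → Prop
  | _, h, [] => h < k ∧ h = 0
  | _, h, .NE :: l => h < k ∧ IsWalk k true (h + 1) l
  | _, h, .SE :: l => h < k ∧ 0 < h ∧ IsWalk k false (h - 1) l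
  | b, h, .S :: l => h < k ∧ b = true ∧ 0 < h ∧ IsWalk k false (h - 1) l
  | _, h, .E :: l => h < k ∧ h = 0 ∧ l ≠ [] ∧ IsWalk k false 0 l

lemma IsWalk.lt {k : ℕ} {b : Bool} {h : ℕ} {l : List PStep} (hl : IsWalk k b h l) : h < k := by
  rcases l with - | ⟨_ | _ | _ | _, l⟩ <;> exact hl.1

/-- The number of peaks, where the Boolean records whether the preceding step was North-East. -/
def walkPeaks : Bool → List PStep → ℕ
  | _, [] => 0
  | _, .NE :: l => walkPeaks true l
  | b, .SE :: l => walkPeaks false l + b.toNat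
  | b, .S :: l => walkPeaks false l + b.toNat
  | _, .E :: l => walkPeaks false l

/-- The sum of the `x`-coordinates of the peaks of a path starting at abscissa `x`, where the
Boolean records whether the preceding step was North-East. -/
def walkMajor : Bool → ℕ → List PStep → ℕ
  | _, _, [] => 0
  | _, x, .NE :: l => walkMajor true (x + 1) l
  | b, x, .SE :: l => walkMajor false (x + 1) l + b.toNat * x
  | b, x, .S :: l => walkMajor false x l + b.toNat * x
  | _, x, .E :: l => walkMajor false (x + 1) l

lemma walkMajor_add (l : List PStep) : ∀ (b : Bool) (x y : ℕ),
    walkMajor b (x + y) l = walkMajor b x l + y * walkPeaks b l := by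
  induction l with
  | nil => simp [walkMajor, walkPeaks]
  | cons s l ih =>
    intro b x y
    cases s <;> simp only [walkMajor, walkPeaks, add_right_comm x y 1, ih] <;> ring

lemma pathHeight_cons (h : ℕ) (s : PStep) (l : List PStep) :
    pathHeight h (s :: l) = pathHeight h l + stepDy s := by
  simp [pathHeight]; ring

/-- The special conditions for a path whose preceding step is recorded by the Boolean. -/
def IsSpecialFrom (k : ℕ) (b : Bool) (h : ℕ) (l : List PStep) : Prop :=
  (∀ m : ℕ, 0 ≤ pathHeight h (l.take m)) ∧
  (∀ m : ℕ, l[m]? = some PStep.S → (m = 0 ∧ b = true) ∨ ∃ m', m = m' + 1 ∧ l[m']? = some PStep.NE) ∧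
  (∀ m : ℕ, l[m]? = some PStep.E → pathHeight h (l.take m) = 0) ∧
  pathHeight h l = 0 ∧
  (l = [] ∨ l.getLast? = some PStep.SE ∨ l.getLast? = some PStep.S) ∧
  ∀ m : ℕ, pathHeight h (l.take m) < k

lemma pathHeight_nil (h : ℕ) : pathHeight h [] = h := by simp [pathHeight]

lemma isSpecialFrom_nil (k : ℕ) (b : Bool) (h : ℕ) : IsSpecialFrom k b h [] ↔ h < k ∧ h = 0 := by
  simp [IsSpecialFrom, pathHeight_nil, and_comm]

lemma getLast?_cons_iff (s : PStep) (l : List PStep) :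
    (s :: l = [] ∨ (s :: l).getLast? = some PStep.SE ∨ (s :: l).getLast? = some PStep.S) ↔
      (l = [] ∧ (s = .SE ∨ s = .S)) ∨
        (l ≠ [] ∧ (l = [] ∨ l.getLast? = some PStep.SE ∨ l.getLast? = some PStep.S)) := by
  cases l with
  | nil => simp
  | cons a l => simp [List.getLast?_cons_cons]

lemma south_condition_cons (b : Bool) (s : PStep) (l : List PStep) :
    (∀ m : ℕ, (s :: l)[m]? = some PStep.S →
      (m = 0 ∧ b = true) ∨ ∃ m', m = m' + 1 ∧ (s :: l)[m']? = some PStep.NE) ↔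
    (s = .S → b = true) ∧ ∀ m : ℕ, l[m]? = some PStep.S →
      (m = 0 ∧ decide (s = .NE) = true) ∨ ∃ m', m = m' + 1 ∧ l[m']? = some PStep.NE := by
  rw [← Nat.and_forall_add_one]
  refine and_congr (by simp) (forall_congr' fun m => ?_)
  cases m with
  | zero => simp
  | succ m => simp

lemma isSpecialFrom_cons (k : ℕ) (b : Bool) (h h' : ℕ) (s : PStep) (l : List PStep)
    (hs : (h' : ℤ) = h + stepDy s) :
    IsSpecialFrom k b h (s :: l) ↔ h < k ∧ (s = .S → b = true) ∧ (s = .E → h = 0) ∧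
      (l = [] → s = .SE ∨ s = .S) ∧ IsSpecialFrom k (decide (s = .NE)) h' l := by
  have hp : ∀ l : List PStep, pathHeight h (s :: l) = pathHeight h' l := fun l => by
    simp [pathHeight, hs, add_assoc]
  unfold IsSpecialFrom
  rw [south_condition_cons, getLast?_cons_iff]
  rw [← Nat.and_forall_add_one (p := fun m => 0 ≤ pathHeight h ((s :: l).take m)),
    ← Nat.and_forall_add_one (p := fun m => pathHeight h ((s :: l).take m) < k),
    ← Nat.and_forall_add_one (p := fun m => (s :: l)[m]? = some PStep.E →
      pathHeight h ((s :: l).take m) = 0)]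
  simp only [List.take_succ_cons, hp, List.take_zero, pathHeight_nil, List.getElem?_cons_zero,
    List.getElem?_cons_succ, Option.some.injEq, Nat.cast_lt, Nat.cast_eq_zero, Nat.cast_nonneg]
  by_cases hl : l = [] <;> simp only [hl] <;> tauto

lemma isSpecialFrom_iff_isWalk (k : ℕ) (l : List PStep) : ∀ (b : Bool) (h : ℕ),
    IsSpecialFrom k b h l ↔ IsWalk k b h l := by
  induction l with
  | nil => exact fun b h => isSpecialFrom_nil k b h
  | cons s l ih =>
    intro b h
    have hneg : 0 + stepDy s < 0 → ¬ IsSpecialFrom k b 0 (s :: l) := by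
      intro hs hsp
      have := hsp.1 1
      simp only [List.take_succ_cons, List.take_zero, pathHeight_cons, pathHeight_nil] at this
      push_cast at this
      omega
    cases s with
    | NE =>
      rw [isSpecialFrom_cons k b h (h + 1) _ _ (by simp [stepDy]), IsWalk, ih]
      have : l = [] → ¬ IsWalk k true (h + 1) l := by rintro rfl; simp [IsWalk]
      simp
      tauto
    | SE =>
      cases h with
      | zero => simpa [IsWalk] using hneg (by simp [stepDy])
      | succ h =>
        rw [isSpecialFrom_cons k b (h + 1) h _ _ (by simp [stepDy]), IsWalk, ih]
        simp
    | S =>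
      cases h with
      | zero => simpa [IsWalk] using hneg (by simp [stepDy])
      | succ h =>
        rw [isSpecialFrom_cons k b (h + 1) h _ _ (by simp [stepDy]), IsWalk, ih]
        simp
    | E =>
      rw [isSpecialFrom_cons k b h h _ _ (by simp [stepDy]), IsWalk, ih]
      simp
      rintro - rfl
      tauto

lemma specialPath_iff_isWalk (k i : ℕ) (l : List PStep) :
    SpecialPath k i l ↔ IsWalk k false (k - i) l := by
  rw [← isSpecialFrom_iff_isWalk]
  simp only [SpecialPath, ValidPath, IsSpecialFrom, Bool.false_eq_true, and_false, false_or]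
  tauto

lemma isPeak_cons_zero (s : PStep) (l : List PStep) : IsPeak (s :: l) 0 ↔
    s = .NE ∧ (l[0]? = some PStep.SE ∨ l[0]? = some PStep.S) := by
  simp [IsPeak]

lemma isPeak_cons_succ (s : PStep) (l : List PStep) (m : ℕ) :
    IsPeak (s :: l) (m + 1) ↔ IsPeak l m := by
  simp [IsPeak]

lemma walkMajor_eq_sum (l : List PStep) : ∀ (b : Bool) (x : ℕ), walkMajor b x l =
    (if b = true ∧ (l[0]? = some PStep.SE ∨ l[0]? = some PStep.S) then x else 0) +
      ∑ m ∈ Finset.range l.length, if IsPeak l m then x + pathX (l.take (m + 1)) else 0 := by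
  induction l with
  | nil => simp [walkMajor]
  | cons s l ih =>
    intro b x
    rw [List.length_cons, Finset.sum_range_succ']
    simp only [isPeak_cons_succ, isPeak_cons_zero]
    cases s <;> cases b <;> simp [walkMajor, ih, pathX, stepDx, add_assoc, add_comm, add_left_comm]

lemma majorIndex_eq_walkMajor (l : List PStep) : majorIndex l = walkMajor false 0 l := by
  simp [walkMajor_eq_sum, majorIndex]

/-! ### Sums over lists of steps -/

lemma hasSum_list {α : Type*} [AddCommMonoid α] [TopologicalSpace α] [ContinuousAdd α]
    {f : List PStep → α} {a : PStep → α} (h : ∀ s, HasSum (fun l => f (s :: l)) (a s)) :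
    HasSum f (f [] + (a .NE + a .SE + a .S + a .E)) := by
  have hcons : ∀ s, HasSum (fun l : List PStep => if l.head? = some s then f l else 0) (a s) := by
    intro s
    refine ((List.cons_injective (a := s)).hasSum_iff ?_).mp ?_
    · intro l hl
      cases l with
      | nil => simp
      | cons s' l =>
        have : s' ≠ s := by rintro rfl; exact hl ⟨l, rfl⟩
        simp [this]
    · simpa [Function.comp_def] using h s
  have hnil : HasSum (fun l : List PStep => if l = [] then f l else 0) (f []) := by
    simpa using hasSum_single (f := fun l : List PStep => if l = [] then f l else 0) []
      (fun l hl => by simp [hl])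
  convert hnil.add ((((hcons .NE).add (hcons .SE)).add (hcons .S)).add (hcons .E)) using 2 with l
  cases l with
  | nil => simp
  | cons s l => cases s <;> simp

lemma tsum_list_ennreal (f : List PStep → ENNReal) :
    ∑' l, f l = f [] + (∑' l, f (.NE :: l) + ∑' l, f (.SE :: l) + ∑' l, f (.S :: l)
      + ∑' l, f (.E :: l)) :=
  (hasSum_list (a := fun s => ∑' l, f (s :: l)) fun _ => ENNReal.summable.hasSum).tsum_eq

lemma tsum_list {f : List PStep → ℂ} (hf : Summable f) :
    ∑' l, f l = f [] + (∑' l, f (.NE :: l) + ∑' l, f (.SE :: l) + ∑' l, f (.S :: l)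
      + ∑' l, f (.E :: l)) :=
  (hasSum_list (a := fun s => ∑' l, f (s :: l)) fun _ =>
    (hf.comp_injective List.cons_injective).hasSum).tsum_eq

/-! ### The weight of a path -/

/-- The weight `q ^ (major index - number of South steps)` of a path starting at abscissa `x`. -/
noncomputable def walkWeight (q : ℂ) (b : Bool) (x : ℕ) (l : List PStep) : ℂ :=
  q ^ ((walkMajor b x l : ℤ) - (southSteps l : ℤ))

section Weight

variable {q : ℂ}

lemma southSteps_NE (l : List PStep) : southSteps (.NE :: l) = southSteps l := by
  rw [southSteps, List.count_cons]; rfl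

lemma southSteps_SE (l : List PStep) : southSteps (.SE :: l) = southSteps l := by
  rw [southSteps, List.count_cons]; rfl

lemma southSteps_E (l : List PStep) : southSteps (.E :: l) = southSteps l := by
  rw [southSteps, List.count_cons]; rfl

lemma southSteps_S (l : List PStep) : southSteps (.S :: l) = southSteps l + 1 := by
  rw [southSteps, List.count_cons]; rfl

lemma walkWeight_nil (b : Bool) (x : ℕ) : walkWeight q b x [] = 1 := by
  simp [walkWeight, walkMajor, southSteps]

lemma walkWeight_NE (b : Bool) (x : ℕ) (l : List PStep) :
    walkWeight q b x (.NE :: l) = walkWeight q true (x + 1) l := by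
  simp [walkWeight, walkMajor, southSteps_NE]

lemma walkWeight_E (b : Bool) (x : ℕ) (l : List PStep) :
    walkWeight q b x (.E :: l) = walkWeight q false (x + 1) l := by
  simp [walkWeight, walkMajor, southSteps_E]

lemma walkWeight_SE (hq0 : q ≠ 0) (b : Bool) (x : ℕ) (l : List PStep) :
    walkWeight q b x (.SE :: l) = q ^ (b.toNat * x) * walkWeight q false (x + 1) l := by
  simp only [walkWeight, walkMajor, southSteps_SE]
  rw [← zpow_natCast, ← zpow_add₀ hq0]
  congr 1
  push_cast
  ring

lemma walkWeight_S (hq0 : q ≠ 0) (b : Bool) (x : ℕ) (l : List PStep) :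
    walkWeight q b x (.S :: l) = q ^ (b.toNat * x) * q⁻¹ * walkWeight q false x l := by
  simp only [walkWeight, walkMajor, southSteps_S]
  rw [← zpow_natCast, ← zpow_neg_one, ← zpow_add₀ hq0, ← zpow_add₀ hq0]
  congr 1
  push_cast
  ring

lemma walkWeight_one (hq0 : q ≠ 0) (b : Bool) (l : List PStep) :
    walkWeight q b 1 l = q ^ walkPeaks b l * walkWeight q b 0 l := by
  rw [walkWeight, walkWeight, ← zpow_natCast, ← zpow_add₀ hq0]
  congr 1
  have := walkMajor_add l b 0 1
  rw [zero_add] at this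
  rw [this]
  push_cast
  ring

end Weight

/-! ### Summability of the weights -/

/-- The sum of the absolute weights of the paths of length at most `L`. -/
noncomputable def boundedSum (q : ℂ) (k L : ℕ) (b : Bool) (h x : ℕ) : ENNReal :=
  ∑' l : List PStep, if IsWalk k b h l ∧ l.length ≤ L then ‖walkWeight q b x l‖ₑ else 0

section Bound

variable {q : ℂ} {k : ℕ}

lemma boundedSum_of_le (L : ℕ) (b : Bool) {h : ℕ} (x : ℕ) (hk : k ≤ h) :
    boundedSum q k L b h x = 0 := by
  refine ENNReal.tsum_eq_zero.mpr fun l => if_neg fun hl => ?_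
  exact absurd hl.1.lt hk.not_gt

lemma boundedSum_zero_le (b : Bool) (h x : ℕ) :
    boundedSum q k 0 b h x ≤ if h = 0 then 1 else 0 := by
  rw [boundedSum, tsum_eq_single []]
  · simp only [IsWalk, walkWeight_nil]
    split_ifs <;> simp_all
  · intro l hl
    simp [hl]

lemma boundedSum_succ_true (hq0 : q ≠ 0) (L : ℕ) {h : ℕ} (x : ℕ) (hk : h + 1 < k) :
    boundedSum q k (L + 1) true (h + 1) x = boundedSum q k L true (h + 2) (x + 1) +
      ‖q‖ₑ ^ x * boundedSum q k L false h (x + 1) +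
      ‖q‖ₑ ^ x * ‖q⁻¹‖ₑ * boundedSum q k L false h x := by
  rw [boundedSum, tsum_list_ennreal]
  simp only [IsWalk, walkWeight_NE, walkWeight_SE hq0, walkWeight_S hq0, boundedSum,
    ← ENNReal.tsum_mul_left, enorm_mul, enorm_pow, mul_ite, mul_zero]
  simp [hk]

lemma boundedSum_succ_false_succ (hq0 : q ≠ 0) (L : ℕ) {h : ℕ} (x : ℕ) (hk : h + 1 < k) :
    boundedSum q k (L + 1) false (h + 1) x = boundedSum q k L true (h + 2) (x + 1) +
      boundedSum q k L false h (x + 1) := by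
  rw [boundedSum, tsum_list_ennreal]
  simp only [IsWalk, walkWeight_NE, walkWeight_SE hq0, walkWeight_S hq0, boundedSum]
  simp [hk]

lemma boundedSum_succ_false_zero (L : ℕ) (x : ℕ) (hk : 0 < k) :
    boundedSum q k (L + 1) false 0 x = boundedSum q k L true 1 (x + 1) +
      boundedSum q k L false 0 (x + 1) := by
  have hE : boundedSum q k L false 0 (x + 1) = 1 + ∑' l : List PStep,
      if (l ≠ [] ∧ IsWalk k false 0 l) ∧ l.length ≤ L then ‖walkWeight q false (x + 1) l‖ₑ
      else 0 := by
    rw [boundedSum, ← tsum_ite_eq ([] : List PStep) (fun _ => (1 : ENNReal)), ← ENNReal.tsum_add]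
    refine tsum_congr fun l => ?_
    by_cases hl : l = []
    · simp [hl, IsWalk, hk, walkWeight_nil]
    · simp [hl]
  rw [hE, boundedSum, tsum_list_ennreal]
  simp only [IsWalk, walkWeight_NE, walkWeight_E, walkWeight_nil, boundedSum]
  simp [hk, add_left_comm]

/-- The majorant of the generating function of paths starting at abscissa `x`. -/
noncomputable def majorant (t : ℝ) (k x : ℕ) : ℝ := Real.exp (2 * k / (1 - t) * t ^ x)

lemma majorant_succ_le {t : ℝ} (ht0 : 0 < t) (ht1 : t < 1) (k x : ℕ) :
    majorant t k (x + 1) ≤ majorant t k x := by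
  have : 0 < 1 - t := by linarith
  unfold majorant
  exact Real.exp_le_exp.mpr (mul_le_mul_of_nonneg_left
    (pow_le_pow_of_le_one ht0.le ht1.le (Nat.le_succ x)) (by positivity))

lemma one_add_mul_majorant_le {t : ℝ} (ht1 : t < 1) (k x : ℕ) :
    (1 + 2 * k * t ^ x) * majorant t k (x + 1) ≤ majorant t k x := by
  have h1 : 0 < 1 - t := by linarith
  have h2 : 2 * k / (1 - t) * t ^ x = 2 * k * t ^ x + 2 * k / (1 - t) * t ^ (x + 1) := by
    field_simp
    ring
  unfold majorant
  rw [h2, Real.exp_add]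
  gcongr
  linarith [Real.add_one_le_exp (2 * k * t ^ x)]

lemma boundedSum_le (hq0 : q ≠ 0) (hq : ‖q‖ < 1) (L : ℕ) : ∀ h x : ℕ,
    boundedSum q k L false h x ≤ ENNReal.ofReal (majorant ‖q‖ k x) ∧
    boundedSum q k L true (h + 1) x ≤
      ENNReal.ofReal ((k - (h + 1) : ℕ) * (2 / ‖q‖) * ‖q‖ ^ x * majorant ‖q‖ k x) := by
  have ht0 : 0 < ‖q‖ := norm_pos_iff.mpr hq0
  set t := ‖q‖ with ht
  have hpos : ∀ x, 0 < majorant t k x := fun x => Real.exp_pos _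
  have hcast : ‖q‖ₑ = ENNReal.ofReal t := (ofReal_norm q).symm
  have hcast' : ‖q⁻¹‖ₑ = ENNReal.ofReal t⁻¹ := by rw [← ofReal_norm, norm_inv]
  induction L with
  | zero =>
    refine fun h x => ⟨(boundedSum_zero_le _ _ _).trans ?_, (boundedSum_zero_le _ _ _).trans ?_⟩
    · have : (1 : ENNReal) ≤ ENNReal.ofReal (majorant t k x) := by
        rw [ENNReal.one_le_ofReal]
        have : 0 < 1 - t := by linarith
        exact Real.one_le_exp (by positivity)
      split_ifs
      exacts [this, zero_le]
    · simp
  | succ L ih =>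
    have hfalse : ∀ h x, boundedSum q k L true (h + 1) (x + 1) ≤
        ENNReal.ofReal (2 * k * t ^ x * majorant t k (x + 1)) := by
      refine fun h x => (ih h (x + 1)).2.trans (ENNReal.ofReal_le_ofReal ?_)
      have hp := hpos (x + 1)
      have : ((k - (h + 1) : ℕ) : ℝ) ≤ k := by exact_mod_cast Nat.sub_le _ _
      calc _ = ((k - (h + 1) : ℕ) : ℝ) * (2 * t ^ x * majorant t k (x + 1)) := by
            field_simp
            ring
        _ ≤ k * (2 * t ^ x * majorant t k (x + 1)) := by gcongr
        _ = _ := by ring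
    have hadd : ∀ h' h x, boundedSum q k L true (h + 1) (x + 1) +
        boundedSum q k L false h' (x + 1) ≤ ENNReal.ofReal (majorant t k x) := by
      intro h' h x
      refine (add_le_add (hfalse h x) (ih h' (x + 1)).1).trans ?_
      have hp := hpos (x + 1)
      rw [← ENNReal.ofReal_add (by positivity) hp.le]
      exact ENNReal.ofReal_le_ofReal (le_trans (by linarith) (one_add_mul_majorant_le hq k x))
    intro h x
    constructor
    · rcases le_or_gt k h with hk | hk
      · rw [boundedSum_of_le _ _ _ hk]; exact zero_le
      · cases h with
        | zero => rw [boundedSum_succ_false_zero L x hk]; exact hadd 0 0 x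
        | succ h => rw [boundedSum_succ_false_succ hq0 L x hk]; exact hadd h (h + 1) x
    · rcases le_or_gt k (h + 1) with hk | hk
      · rw [boundedSum_of_le _ _ _ hk]; exact zero_le
      · rw [boundedSum_succ_true hq0 L x hk]
        have hp := hpos x
        have hp' := hpos (x + 1)
        have hle := majorant_succ_le ht0 hq k x
        refine (add_le_add (add_le_add (ih (h + 1) (x + 1)).2
          (mul_le_mul_right (ih h (x + 1)).1 _)) (mul_le_mul_right (ih h x).1 _)).trans ?_
        rw [hcast, hcast', ← ENNReal.ofReal_pow ht0.le, ← ENNReal.ofReal_mul (by positivity),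
          ← ENNReal.ofReal_mul (by positivity), ← ENNReal.ofReal_mul (by positivity),
          ← ENNReal.ofReal_add (by positivity) (by positivity),
          ← ENNReal.ofReal_add (by positivity) (by positivity)]
        refine ENNReal.ofReal_le_ofReal ?_
        obtain ⟨d, hd⟩ : ∃ d : ℕ, k = d + (h + 2) := ⟨k - (h + 2), by omega⟩
        have e1 : k - (h + 1 + 1) = d := by omega
        have e2 : k - (h + 1) = d + 1 := by omega
        rw [e1, e2]
        have hinv : 1 ≤ t⁻¹ := (one_le_inv₀ ht0).mpr hq.le
        calc _ ≤ d * (2 / t) * t ^ x * majorant t k x + t ^ x * t⁻¹ * majorant t k x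
              + t ^ x * t⁻¹ * majorant t k x := by
              gcongr ?_ + ?_ + _
              · gcongr ?_ * ?_ * ?_ * ?_
                exact pow_le_pow_of_le_one ht0.le hq.le (Nat.le_succ x)
              · gcongr ?_ * ?_
                exact le_mul_of_one_le_right (by positivity) hinv
          _ = _ := by
              push_cast
              field_simp
              ring

lemma tsum_le_of_boundedSum_le {b : Bool} {h x : ℕ} {B : ENNReal}
    (hB : ∀ L, boundedSum q k L b h x ≤ B) :
    ∑' l : List PStep, (if IsWalk k b h l then ‖walkWeight q b x l‖ₑ else 0) ≤ B := by
  rw [ENNReal.tsum_eq_iSup_sum]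
  refine iSup_le fun s => le_trans ?_ (hB (s.sup List.length))
  refine le_trans (Finset.sum_le_sum fun l hl => ?_) (ENNReal.sum_le_tsum s)
  have : l.length ≤ s.sup List.length := Finset.le_sup (f := List.length) hl
  simp [this]

lemma summable_of_boundedSum_le {b : Bool} {h x : ℕ} {B : ENNReal} (hfin : B ≠ ⊤)
    (hB : ∀ L, boundedSum q k L b h x ≤ B) :
    Summable fun l : List PStep => if IsWalk k b h l then walkWeight q b x l else 0 := by
  refine Summable.of_norm ?_
  have h1 := ((tsum_le_of_boundedSum_le hB).trans_lt hfin.lt_top).ne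
  refine (ENNReal.summable_toReal h1).congr fun l => ?_
  split_ifs <;> simp

lemma summable_walkWeight_false (hq0 : q ≠ 0) (hq : ‖q‖ < 1) (h : ℕ) :
    Summable fun l : List PStep => if IsWalk k false h l then walkWeight q false 0 l else 0 :=
  summable_of_boundedSum_le ENNReal.ofReal_ne_top fun L => (boundedSum_le hq0 hq L h 0).1

lemma summable_walkWeight_true (hq0 : q ≠ 0) (hq : ‖q‖ < 1) (h : ℕ) :
    Summable fun l : List PStep =>
      if IsWalk k true (h + 1) l then walkWeight q true 0 l else 0 :=
  summable_of_boundedSum_le ENNReal.ofReal_ne_top fun L => (boundedSum_le hq0 hq L h 0).2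

end Bound

/-! ### Generating functions graded by the number of peaks -/

/-- The generating function of the paths with `N` peaks. -/
noncomputable def gradedSum (q : ℂ) (k : ℕ) (b : Bool) (h N : ℕ) : ℂ :=
  ∑' l : List PStep, if IsWalk k b h l ∧ walkPeaks b l = N then walkWeight q b 0 l else 0

section Graded

variable {q : ℂ} {k : ℕ}

lemma summable_graded {b : Bool} {h : ℕ}
    (hs : Summable fun l : List PStep => if IsWalk k b h l then walkWeight q b 0 l else 0)
    (N : ℕ) : Summable fun l : List PStep =>
      if IsWalk k b h l ∧ walkPeaks b l = N then walkWeight q b 0 l else 0 := by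
  refine (hs.indicator {l | walkPeaks b l = N}).congr fun l => ?_
  simp only [Set.indicator_apply, Set.mem_ofPred_eq]
  split_ifs <;> tauto

lemma tsum_walkWeight_one (hq0 : q ≠ 0) (b : Bool) (h N : ℕ) :
    ∑' l : List PStep, (if IsWalk k b h l ∧ walkPeaks b l = N then walkWeight q b 1 l else 0) =
      q ^ N * gradedSum q k b h N := by
  rw [gradedSum, ← tsum_mul_left]
  refine tsum_congr fun l => ?_
  split_ifs with hl
  · rw [walkWeight_one hq0, hl.2]
  · simp

lemma gradedSum_of_le {b : Bool} {h : ℕ} (hk : k ≤ h) (N : ℕ) : gradedSum q k b h N = 0 := by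
  have : ∀ l, ¬ IsWalk k b h l := fun l hl => absurd hl.lt hk.not_gt
  simp [gradedSum, this]

lemma gradedSum_false_succ (hq0 : q ≠ 0) (hq : ‖q‖ < 1) {h : ℕ} (hk : h + 1 < k) (N : ℕ) :
    gradedSum q k false (h + 1) N =
      q ^ N * gradedSum q k true (h + 2) N + q ^ N * gradedSum q k false h N := by
  rw [← tsum_walkWeight_one hq0, ← tsum_walkWeight_one hq0, gradedSum,
    tsum_list (summable_graded (summable_walkWeight_false hq0 hq _) N)]
  simp [IsWalk, walkPeaks, walkWeight_NE, walkWeight_SE hq0, hk]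

lemma gradedSum_false_zero (hq0 : q ≠ 0) (hq : ‖q‖ < 1) (hk : 0 < k) (N : ℕ) :
    gradedSum q k false 0 (N + 1) = q ^ (N + 1) * gradedSum q k true 1 (N + 1) +
      q ^ (N + 1) * gradedSum q k false 0 (N + 1) := by
  rw [← tsum_walkWeight_one hq0, ← tsum_walkWeight_one hq0, gradedSum,
    tsum_list (summable_graded (summable_walkWeight_false hq0 hq _) (N + 1))]
  simp only [IsWalk, walkPeaks, walkWeight_NE, walkWeight_E]
  simp only [hk, true_and, lt_irrefl, false_and, and_false, if_false, tsum_zero, add_zero,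
    zero_add, and_true, (Nat.succ_ne_zero N).symm]
  congr 1
  refine tsum_congr fun l => ?_
  by_cases hl : l = []
  · simp [hl, walkPeaks]
  · simp [hl]

lemma gradedSum_true_succ (hq0 : q ≠ 0) (hq : ‖q‖ < 1) {h : ℕ} (hk : h + 1 < k) (N : ℕ) :
    gradedSum q k true (h + 1) (N + 1) = q ^ (N + 1) * gradedSum q k true (h + 2) (N + 1) +
      q ^ N * gradedSum q k false h N + q⁻¹ * gradedSum q k false h N := by
  rw [← tsum_walkWeight_one hq0, ← tsum_walkWeight_one hq0, gradedSum,
    tsum_list (summable_graded (summable_walkWeight_true hq0 hq _) (N + 1)), gradedSum,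
    ← tsum_mul_left]
  simp [IsWalk, walkPeaks, walkWeight_NE, walkWeight_SE hq0, walkWeight_S hq0, hk]

lemma eq_replicate_of_walkPeaks_eq_zero (l : List PStep) : ∀ (b : Bool) (h : ℕ),
    IsWalk k b h l → walkPeaks b l = 0 → (b = false ∨ h = 0) ∧ l = List.replicate h .SE := by
  induction l with
  | nil => rintro b h ⟨-, rfl⟩ -; simp
  | cons s l ih =>
    intro b h hw hp
    cases s with
    | NE => simpa using (ih true (h + 1) hw.2 hp).1
    | SE =>
      obtain ⟨hp, hb⟩ := Nat.add_eq_zero_iff.mp hp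
      obtain ⟨h, rfl⟩ := Nat.exists_eq_add_one.mpr hw.2.1
      refine ⟨Or.inl (by simpa using hb), ?_⟩
      rw [List.replicate_succ, (ih false h hw.2.2 hp).2]
    | S =>
      obtain ⟨-, hb⟩ := Nat.add_eq_zero_iff.mp hp
      simp [hw.2.1] at hb
    | E =>
      exact absurd (ih false 0 hw.2.2.2 hp).2 hw.2.2.1

lemma isWalk_replicate {h : ℕ} (hk : h < k) : IsWalk k false h (List.replicate h .SE) ∧
    walkPeaks false (List.replicate h .SE) = 0 ∧
    ∀ x, walkWeight q false x (List.replicate h .SE) = 1 := by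
  induction h with
  | zero => simp [IsWalk, walkPeaks, walkWeight_nil, hk]
  | succ h ih =>
    obtain ⟨h1, h2, h3⟩ := ih (by omega)
    have : ∀ x l, walkWeight q false x (.SE :: l) = walkWeight q false (x + 1) l := fun x l => by
      simp [walkWeight, walkMajor, southSteps_SE]
    simp [List.replicate_succ, IsWalk, walkPeaks, this, h1, h2, h3, hk]

lemma gradedSum_false_peaks_zero {h : ℕ} (hk : h < k) : gradedSum q k false h 0 = 1 := by
  obtain ⟨h1, h2, h3⟩ := isWalk_replicate (q := q) hk
  rw [gradedSum, tsum_eq_single (List.replicate h .SE), if_pos ⟨h1, h2⟩, h3]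
  intro l hl
  exact if_neg fun hw => hl (eq_replicate_of_walkPeaks_eq_zero l _ _ hw.1 hw.2).2

lemma gradedSum_true_eq (hq0 : q ≠ 0) (hq : ‖q‖ < 1) {N : ℕ}
    (ih : ∀ h < k, gradedSum q k false h N = pathSeries q k h N) (d : ℕ) : ∀ h : ℕ, h + d + 1 = k →
    q ^ (N + 1) * gradedSum q k true (h + 1) (N + 1) =
      pathSeries q k h (N + 1) - q ^ (N + 1) * pathSeries q k (h - 1) (N + 1) := by
  induction d with
  | zero =>
    rintro h rfl
    rw [gradedSum_of_le le_rfl]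
    have := pathSeries_top hq0 hq (h + 0 + 1) (N + 1)
    rw [show (((h + 0 + 1 : ℕ) : ℤ) - 1) = h by push_cast; ring,
      show (((h + 0 + 1 : ℕ) : ℤ) - 2) = h - 1 by push_cast; ring] at this
    rw [this]
    ring
  | succ d ihd =>
    intro h hd
    have h1 := ihd (h + 1) (by omega)
    have h2 := pathSeries_recurrence hq0 hq k h N
    push_cast at h1
    rw [add_sub_cancel_right] at h1
    rw [gradedSum_true_succ hq0 hq (by omega), ih h (by omega), h2, ← h1, pow_succ]
    field_simp
    ring

lemma gradedSum_false_eq (hq0 : q ≠ 0) (hq : ‖q‖ < 1) (N : ℕ) :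
    ∀ h < k, gradedSum q k false h N = pathSeries q k h N := by
  induction N with
  | zero => exact fun h hk => by rw [gradedSum_false_peaks_zero hk, pathSeries_zero]
  | succ N ih =>
    have htrue : ∀ h : ℕ, h < k → q ^ (N + 1) * gradedSum q k true (h + 1) (N + 1) =
        pathSeries q k h (N + 1) - q ^ (N + 1) * pathSeries q k (h - 1) (N + 1) := fun h hk =>
      gradedSum_true_eq hq0 hq ih (k - h - 1) h (by omega)
    intro h
    induction h with
    | zero =>
      intro hk
      have h1 := gradedSum_false_zero hq0 hq hk N
      have h2 := htrue 0 hk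
      rw [Nat.cast_zero, zero_sub, pathSeries_neg_one] at h2
      rw [h2] at h1
      have hne : 1 - q ^ (N + 1) ≠ 0 :=
        one_sub_ne_zero_of_norm_lt_one (norm_pow_lt_one hq (Nat.succ_ne_zero N))
      refine mul_left_cancel₀ hne ?_
      rw [Nat.cast_zero]
      linear_combination h1
    | succ h ihh =>
      intro hk
      rw [gradedSum_false_succ hq0 hq hk, htrue (h + 1) hk, ihh (by omega)]
      push_cast
      rw [add_sub_cancel_right]
      ring

lemma tsum_walkWeight (hq0 : q ≠ 0) (hq : ‖q‖ < 1) {h : ℕ} (hk : h < k) :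
    ∑' l : List PStep, (if IsWalk k false h l then walkWeight q false 0 l else 0) =
      ∑' N, pathSeries q k h N := by
  have hs := summable_walkWeight_false (k := k) hq0 hq h
  rw [← hs.hasSum.tsum_fiberwise (walkPeaks false) |>.tsum_eq]
  refine tsum_congr fun N => ?_
  rw [← gradedSum_false_eq hq0 hq N h hk, gradedSum, tsum_subtype
    (walkPeaks false ⁻¹' {N}) (fun l => if IsWalk k false h l then walkWeight q false 0 l else 0)]
  refine tsum_congr fun l => ?_
  simp only [Set.indicator_apply, Set.mem_preimage, Set.mem_singleton_iff]
  split_ifs <;> tauto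

lemma tsum_Ebar (hq0 : q ≠ 0) (hq : ‖q‖ < 1) (i : ℕ) :
    ∑' p : ℕ × ℕ, (Ebar k i p.1 p.2 : ℂ) * q ^ ((p.1 : ℤ) - (p.2 : ℤ)) =
      ∑' l : List PStep, if IsWalk k false (k - i) l then walkWeight q false 0 l else 0 := by
  have hs := summable_walkWeight_false (k := k) hq0 hq (k - i)
  have hs' : Summable fun l : {l // SpecialPath k i l} => walkWeight q false 0 l := by
    refine (hs.comp_injective Subtype.val_injective).congr fun l => ?_
    simp [(specialPath_iff_isWalk k i l).mp l.2]
  have hsub : ∑' l : {l // SpecialPath k i l}, walkWeight q false 0 l =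
      ∑' l : List PStep, if IsWalk k false (k - i) l then walkWeight q false 0 l else 0 := by
    refine (tsum_subtype {l | SpecialPath k i l} (walkWeight q false 0)).trans
      (tsum_congr fun l => ?_)
    simp only [Set.indicator_apply, Set.mem_ofPred_eq, specialPath_iff_isWalk]
  rw [← hsub, ← (hs'.hasSum.tsum_fiberwise fun l => (majorIndex l.1, southSteps l.1)).tsum_eq]
  refine tsum_congr fun p => ?_
  have hcard : Ebar k i p.1 p.2 = Nat.card ((fun l : {l // SpecialPath k i l} =>
      (majorIndex l.1, southSteps l.1)) ⁻¹' {p}) := by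
    refine Nat.card_congr (((Equiv.subtypeSubtypeEquivSubtypeInter _ _).symm).trans
      (Equiv.subtypeEquivRight fun l => ?_))
    simp [Prod.ext_iff]
  rw [hcard, ← nsmul_eq_mul, ← tsum_const]
  refine tsum_congr fun l => ?_
  obtain ⟨l, rfl⟩ := l
  simp only [walkWeight, majorIndex_eq_walkMajor]

end Graded

/-- **Corollary 1.6, equation (1.6).** For `k ≥ i ≥ 1` and `0 < |q| < 1`,
`Σ_{n,j} Ē_{k,i}(n,j) q^{n-j} = ((-q;q)_∞/(q;q)_∞) ((qⁱ, q^{2k-i}, q^{2k}; q^{2k})_∞ + (q^{i-1}, q^{2k+1-i}, q^{2k}; q^{2k})_∞)`. -/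
theorem gen_fun_E_a_inv_q (k i : ℕ) (hi : 1 ≤ i) (hik : i ≤ k) (q : ℂ)
    (hq0 : 0 < ‖q‖) (hq1 : ‖q‖ < 1) :
    ∑' p : ℕ × ℕ, (Ebar k i p.1 p.2 : ℂ) * q ^ ((p.1 : ℤ) - (p.2 : ℤ)) =
      qPochInf (-q) q / qPochInf q q *
        (qPochInf (q ^ i) (q ^ (2 * k)) * qPochInf (q ^ (2 * k - i)) (q ^ (2 * k)) *
            qPochInf (q ^ (2 * k)) (q ^ (2 * k)) +
          qPochInf (q ^ (i - 1)) (q ^ (2 * k)) * qPochInf (q ^ (2 * k + 1 - i)) (q ^ (2 * k)) *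
            qPochInf (q ^ (2 * k)) (q ^ (2 * k))) := by
  have hne : q ≠ 0 := norm_pos_iff.mp hq0
  rw [tsum_Ebar hne hq1, tsum_walkWeight hne hq1 (by omega),
    tsum_pathSeries_eq_qPochInf hne hq1 hi hik]

end Paper
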